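/- arXiv:1811.07572 — 2 statements merged into one kernel-verified Lean document; each statement's English description precedes it below -/
import Mathlib

section
/- Let V be a K-vector space equipped with a family of bilinear products (•_t)_{t∈𝒯}. Define a bilinear product • on V^{⊕𝒯} = ⊕_{t∈𝒯} V δ_t by (x δ_t) • (x' δ_{t'}) = (x •_{t'} x') δ_t. Then (V, (•_t)_{t∈𝒯}) is a 𝒯-multiple prelie algebra if and only if (V^{⊕𝒯}, •) is a prelie algebra. -/
/-- The product `•` on `V^{⊕𝒯} = ⊕_{t∈𝒯} V δ_t` (realized as finitely supported functions
`𝒯 →₀ V`, with `x δ_t = single t x`) determined by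
`(x δ_t) • (x' δ_{t'}) = (x •_{t'} x') δ_t`, extended bilinearly. -/
noncomputable def deltaMul {K V T : Type} [Field K] [AddCommGroup V] [Module K V]
    (mul : T → V →ₗ[K] V →ₗ[K] V) (f g : T →₀ V) : T →₀ V :=
  f.sum fun t x => g.sum fun t' x' => Finsupp.single t (mul t' x x')

section DeltaMul

variable {K V T : Type} [Field K] [AddCommGroup V] [Module K V] (mul : T → V →ₗ[K] V →ₗ[K] V)

theorem deltaMul_single_single (t t' : T) (x x' : V) :
    deltaMul mul (Finsupp.single t x) (Finsupp.single t' x') =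
      Finsupp.single t (mul t' x x') := by
  simp [deltaMul]

theorem deltaMul_zero_left (g : T →₀ V) : deltaMul mul 0 g = 0 := by
  simp [deltaMul]

theorem deltaMul_zero_right (f : T →₀ V) : deltaMul mul f 0 = 0 := by
  simp [deltaMul]

theorem deltaMul_add_left (f f' g : T →₀ V) :
    deltaMul mul (f + f') g = deltaMul mul f g + deltaMul mul f' g := by
  classical
  unfold deltaMul
  refine Finsupp.sum_add_index (by simp) fun t _ x x' => ?_
  simp [← Finsupp.sum_add]

theorem deltaMul_add_right (f g g' : T →₀ V) :
    deltaMul mul f (g + g') = deltaMul mul f g + deltaMul mul f g' := by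
  classical
  unfold deltaMul
  rw [← Finsupp.sum_add]
  refine Finsupp.sum_congr fun t _ => ?_
  exact Finsupp.sum_add_index (by simp) (by simp)

end DeltaMul

/-- `(V, (•_t)_{t∈𝒯})` is a `𝒯`-multiple prelie algebra if and only if
`(V^{⊕𝒯}, •)` is a prelie algebra. -/
theorem multiple_prelie_iff_deltaMul_prelie (K V T : Type) [Field K] [AddCommGroup V]
    [Module K V] [Nonempty T] (mul : T → V →ₗ[K] V →ₗ[K] V) :
    (∀ (t t' : T) (x y z : V),
        mul t' x (mul t y z) - mul t (mul t' x y) z =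
          mul t x (mul t' z y) - mul t' (mul t x z) y) ↔
      (∀ a b c : T →₀ V,
        deltaMul mul a (deltaMul mul b c) - deltaMul mul (deltaMul mul a b) c =
          deltaMul mul a (deltaMul mul c b) - deltaMul mul (deltaMul mul a c) b) := by
  constructor
  · intro h a b c
    induction a using Finsupp.induction_linear with
    | zero => simp only [deltaMul_zero_left]
    | add f g hf hg =>
      simp only [deltaMul_add_left, add_sub_add_comm, hf, hg]
    | single s x =>
      induction b using Finsupp.induction_linear with
      | zero => simp only [deltaMul_zero_left, deltaMul_zero_right]
      | add f g hf hg =>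
        simp only [deltaMul_add_left, deltaMul_add_right, add_sub_add_comm, hf, hg]
      | single t' y =>
        induction c using Finsupp.induction_linear with
        | zero => simp only [deltaMul_zero_left, deltaMul_zero_right]
        | add f g hf hg =>
          simp only [deltaMul_add_left, deltaMul_add_right, add_sub_add_comm, hf, hg]
        | single t z =>
          simp only [deltaMul_single_single, ← Finsupp.single_sub, h t t' x y z]
  · intro h t t' x y z
    have key := h (Finsupp.single t x) (Finsupp.single t' y) (Finsupp.single t z)
    simp only [deltaMul_single_single, ← Finsupp.single_sub] at key
    exact Finsupp.single_injective t key
end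

section
/- Let V be a K-vector space. Then P_𝒯(V) = V ⊗ S(V^{⊕𝒯}) with the products (v ⊗ w) ◇_t (v' ⊗ w') = v ⊗ (w · w' · (v' δ_t)) is a 𝒯-multiple permutative algebra, and it is free on V: for any 𝒯-multiple permutative algebra A and any linear map φ : V → A, there exists a unique linear map Φ : P_𝒯(V) → A satisfying Φ(x ◇_t y) = Φ(x) ◇_t Φ(y) for all x, y ∈ P_𝒯(V) and t ∈ 𝒯, and Φ(v ⊗ 1) = φ(v) for all v ∈ V. -/
open scoped TensorProduct

/-- The symmetrizing relation on the tensor algebra of `M`. -/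
inductive SymRel (K M : Type) [CommRing K] [AddCommGroup M] [Module K M] :
    TensorAlgebra K M → TensorAlgebra K M → Prop
  | comm (x y : M) :
      SymRel K M (TensorAlgebra.ι K x * TensorAlgebra.ι K y)
        (TensorAlgebra.ι K y * TensorAlgebra.ι K x)

/-- The symmetric algebra `S(M)` on the vector space `M`. -/
abbrev SymmAlgebra (K M : Type) [CommRing K] [AddCommGroup M] [Module K M] : Type :=
  RingQuot (SymRel K M)

/-- The canonical inclusion `M → S(M)`. -/
noncomputable def symI (K M : Type) [CommRing K] [AddCommGroup M] [Module K M] :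
    M →ₗ[K] SymmAlgebra K M :=
  (RingQuot.mkAlgHom K (SymRel K M)).toLinearMap ∘ₗ TensorAlgebra.ι K

variable (K V T : Type) [Field K] [AddCommGroup V] [Module K V]

/-- `S(V^{⊕𝒯})`, where `V^{⊕𝒯} = ⊕_{t∈𝒯} V δ_t` is realized as `𝒯 →₀ V`
(`x δ_t = single t x`). -/
abbrev SymVT : Type := SymmAlgebra K (T →₀ V)

/-- `P_𝒯(V) := V ⊗ S(V^{⊕𝒯})`. -/
abbrev PermFree : Type := V ⊗[K] SymVT K V T

/-- The map `V ⊗ S →ₗ S`, `v' ⊗ w' ↦ w' · ι(v' δ_t)`. -/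
noncomputable def diamondAux (t : T) : V ⊗[K] SymVT K V T →ₗ[K] SymVT K V T :=
  LinearMap.mul' K (SymVT K V T) ∘ₗ
    TensorProduct.map LinearMap.id (symI K (T →₀ V) ∘ₗ Finsupp.lsingle t) ∘ₗ
    (TensorProduct.comm K V (SymVT K V T)).toLinearMap

/-- The product `◇_t` on `P_𝒯(V)`: `(v ⊗ w) ◇_t (v' ⊗ w') = v ⊗ (w · w' · ι(v' δ_t))`. -/
noncomputable def diamond (t : T) :
    PermFree K V T →ₗ[K] PermFree K V T →ₗ[K] PermFree K V T :=
  TensorProduct.curry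
    (TensorProduct.map LinearMap.id (LinearMap.mul' K (SymVT K V T)) ∘ₗ
      (TensorProduct.assoc K V (SymVT K V T) (SymVT K V T)).toLinearMap ∘ₗ
      TensorProduct.map LinearMap.id (diamondAux K V T t))

namespace SymmAlgebra

variable {K M : Type} [CommRing K] [AddCommGroup M] [Module K M]

@[elab_as_elim]
theorem induction {motive : SymmAlgebra K M → Prop}
    (algebraMap : ∀ r, motive (algebraMap K (SymmAlgebra K M) r))
    (ι : ∀ x, motive (symI K M x))
    (mul : ∀ a b, motive a → motive b → motive (a * b))
    (add : ∀ a b, motive a → motive b → motive (a + b))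
    (a : SymmAlgebra K M) : motive a := by
  obtain ⟨a, rfl⟩ := RingQuot.mkAlgHom_surjective K (SymRel K M) a
  induction a using TensorAlgebra.induction with
  | algebraMap r => rw [AlgHom.commutes]; exact algebraMap r
  | ι x => exact ι x
  | mul x y hx hy => rw [map_mul]; exact mul _ _ hx hy
  | add x y hx hy => rw [map_add]; exact add _ _ hx hy

theorem symI_mul_comm (x y : M) : symI K M x * symI K M y = symI K M y * symI K M x := by
  simpa [symI] using RingQuot.mkAlgHom_rel K (SymRel.comm (K := K) x y)

protected theorem commute (a b : SymmAlgebra K M) : Commute a b := by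
  induction b using SymmAlgebra.induction with
  | algebraMap r => exact Algebra.commute_algebraMap_right _ _
  | ι x =>
    induction a using SymmAlgebra.induction with
    | algebraMap r => exact Algebra.commute_algebraMap_left _ _
    | ι y => exact symI_mul_comm y x
    | mul a b ha hb => exact ha.mul_left hb
    | add a b ha hb => exact ha.add_left hb
  | mul b c hb hc => exact hb.mul_right hc
  | add b c hb hc => exact hb.add_right hc

instance : Std.Commutative (α := SymmAlgebra K M) (· * ·) :=
  ⟨fun a b => SymmAlgebra.commute a b⟩

/-- A linear map with pairwise commuting values in an algebra `B`, not necessarily commutative,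
extends to an algebra homomorphism on the symmetric algebra. -/
noncomputable def lift {B : Type} [Ring B] [Algebra K B] (f : M →ₗ[K] B)
    (hf : ∀ x y, Commute (f x) (f y)) : SymmAlgebra K M →ₐ[K] B :=
  RingQuot.liftAlgHom K ⟨TensorAlgebra.lift K f, by
    rintro _ _ ⟨x, y⟩
    simpa using (hf x y).eq⟩

@[simp]
theorem lift_symI {B : Type} [Ring B] [Algebra K B] (f : M →ₗ[K] B)
    (hf : ∀ x y, Commute (f x) (f y)) (x : M) : lift f hf (symI K M x) = f x := by
  simp [lift, symI]

end SymmAlgebra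

namespace PermFree

variable {K V T}

@[simp]
theorem diamond_tmul (t : T) (v v' : V) (w w' : SymVT K V T) :
    diamond K V T t (v ⊗ₜ[K] w) (v' ⊗ₜ[K] w') =
      v ⊗ₜ[K] (w * (w' * symI K (T →₀ V) (Finsupp.single t v'))) := by
  simp [diamond, diamondAux]

theorem diamond_assoc (t t' : T) (x y z : PermFree K V T) :
    diamond K V T t' (diamond K V T t x y) z = diamond K V T t x (diamond K V T t' y z) := by
  induction x using TensorProduct.induction_on with
  | zero => simp
  | add x₁ x₂ h₁ h₂ => simp only [map_add, LinearMap.add_apply, h₁, h₂]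
  | tmul v w =>
    induction y using TensorProduct.induction_on with
    | zero => simp
    | add y₁ y₂ h₁ h₂ => simp only [map_add, LinearMap.add_apply, h₁, h₂]
    | tmul v' w' =>
      induction z using TensorProduct.induction_on with
      | zero => simp
      | add z₁ z₂ h₁ h₂ => simp only [map_add, h₁, h₂]
      | tmul v'' w'' =>
        simp only [diamond_tmul]
        congr 1
        ac_rfl

theorem diamond_right_comm (t t' : T) (x y z : PermFree K V T) :
    diamond K V T t' (diamond K V T t x y) z = diamond K V T t (diamond K V T t' x z) y := by
  induction x using TensorProduct.induction_on with
  | zero => simp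
  | add x₁ x₂ h₁ h₂ => simp only [map_add, LinearMap.add_apply, h₁, h₂]
  | tmul v w =>
    induction y using TensorProduct.induction_on with
    | zero => simp
    | add y₁ y₂ h₁ h₂ => simp only [map_add, LinearMap.add_apply, h₁, h₂]
    | tmul v' w' =>
      induction z using TensorProduct.induction_on with
      | zero => simp
      | add z₁ z₂ h₁ h₂ => simp only [map_add, LinearMap.add_apply, h₁, h₂]
      | tmul v'' w'' =>
        simp only [diamond_tmul]
        congr 1
        ac_rfl

variable {A : Type} [AddCommGroup A] [Module K A] (dm : T → A →ₗ[K] A →ₗ[K] A) (φ : V →ₗ[K] A)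

/-- The linear map `V^{⊕𝒯} → End A` sending `v δ_t` to the right multiplication
`x ↦ x ◇_t φ v`. -/
noncomputable def rightMul : (T →₀ V) →ₗ[K] Module.End K A :=
  Finsupp.lsum K fun t => (dm t).flip ∘ₗ φ

@[simp]
theorem rightMul_single (t : T) (v : V) (a : A) :
    rightMul dm φ (Finsupp.single t v) a = dm t a (φ v) := by
  simp [rightMul]

variable {dm}

theorem commute_rightMul (hcomm : ∀ t t' x y z, dm t' (dm t x y) z = dm t (dm t' x z) y)
    (f g : T →₀ V) : Commute (rightMul dm φ f) (rightMul dm φ g) := by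
  induction f using Finsupp.induction_linear with
  | zero => simp
  | add f₁ f₂ h₁ h₂ => rw [map_add]; exact h₁.add_left h₂
  | single t v =>
    induction g using Finsupp.induction_linear with
    | zero => simp
    | add g₁ g₂ h₁ h₂ => rw [map_add]; exact h₁.add_right h₂
    | single t' v' =>
      ext a
      simpa using hcomm t' t a (φ v') (φ v)

/-- The action of `S(V^{⊕𝒯})` on `A` by iterated right multiplications. -/
noncomputable def action (hcomm : ∀ t t' x y z, dm t' (dm t x y) z = dm t (dm t' x z) y) :
    SymVT K V T →ₐ[K] Module.End K A :=
  SymmAlgebra.lift (rightMul dm φ) (commute_rightMul φ hcomm)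

variable (hcomm : ∀ t t' x y z, dm t' (dm t x y) z = dm t (dm t' x z) y)

@[simp]
theorem action_symI (f : T →₀ V) :
    action φ hcomm (symI K (T →₀ V) f) = rightMul dm φ f :=
  SymmAlgebra.lift_symI _ _ f

theorem action_product_left (w : SymVT K V T) (t : T) (a b : A) :
    action φ hcomm w (dm t a b) = dm t (action φ hcomm w a) b := by
  induction w using SymmAlgebra.induction generalizing a with
  | algebraMap r => simp [Module.algebraMap_end_apply]
  | ι f =>
    rw [action_symI]
    induction f using Finsupp.induction_linear with
    | zero => simp
    | add f₁ f₂ h₁ h₂ => simp only [map_add, LinearMap.add_apply, h₁, h₂]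
    | single t' v => simpa using hcomm t t' a b (φ v)
  | mul w₁ w₂ h₁ h₂ => simp only [map_mul, Module.End.mul_apply, h₁, h₂]
  | add w₁ w₂ h₁ h₂ => simp only [map_add, LinearMap.add_apply, h₁, h₂]

theorem action_product_right
    (hassoc : ∀ t t' x y z, dm t' (dm t x y) z = dm t x (dm t' y z))
    (w : SymVT K V T) (t : T) (a b : A) :
    action φ hcomm w (dm t a b) = dm t a (action φ hcomm w b) := by
  induction w using SymmAlgebra.induction generalizing b with
  | algebraMap r => simp [Module.algebraMap_end_apply]
  | ι f =>
    rw [action_symI]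
    induction f using Finsupp.induction_linear with
    | zero => simp
    | add f₁ f₂ h₁ h₂ => simp only [map_add, LinearMap.add_apply, h₁, h₂]
    | single t' v => simpa using hassoc t t' a b (φ v)
  | mul w₁ w₂ h₁ h₂ => simp only [map_mul, Module.End.mul_apply, h₁, h₂]
  | add w₁ w₂ h₁ h₂ => simp only [map_add, LinearMap.add_apply, h₁, h₂]

/-- The extension of `φ : V → A` to `P_𝒯(V)`, sending `v ⊗ w` to the action of `w` on `φ v`. -/
noncomputable def extend : PermFree K V T →ₗ[K] A :=
  TensorProduct.lift ((action φ hcomm).toLinearMap.flip ∘ₗ φ)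

@[simp]
theorem extend_tmul (v : V) (w : SymVT K V T) :
    extend φ hcomm (v ⊗ₜ[K] w) = action φ hcomm w (φ v) := by
  simp [extend]

theorem extend_diamond
    (hassoc : ∀ t t' x y z, dm t' (dm t x y) z = dm t x (dm t' y z))
    (t : T) (x y : PermFree K V T) :
    extend φ hcomm (diamond K V T t x y) = dm t (extend φ hcomm x) (extend φ hcomm y) := by
  induction x using TensorProduct.induction_on with
  | zero => simp
  | add x₁ x₂ h₁ h₂ => simp only [map_add, LinearMap.add_apply, h₁, h₂]
  | tmul v w =>
    induction y using TensorProduct.induction_on with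
    | zero => simp
    | add y₁ y₂ h₁ h₂ => simp only [map_add, h₁, h₂]
    | tmul v' w' =>
      simp only [diamond_tmul, extend_tmul, map_mul, Module.End.mul_apply, action_symI,
        rightMul_single]
      rw [action_product_right φ hcomm hassoc, action_product_left]

theorem map_tmul_mul {Φ : PermFree K V T →ₗ[K] A}
    (hΦ : ∀ t x y, Φ (diamond K V T t x y) = dm t (Φ x) (Φ y))
    (hφ : ∀ v, Φ (v ⊗ₜ[K] (1 : SymVT K V T)) = φ v) (v : V) (w s : SymVT K V T) :
    Φ (v ⊗ₜ[K] (s * w)) = action φ hcomm s (Φ (v ⊗ₜ[K] w)) := by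
  induction s using SymmAlgebra.induction generalizing w with
  | algebraMap r => simp [Module.algebraMap_end_apply, ← Algebra.smul_def]
  | ι f =>
    rw [action_symI]
    induction f using Finsupp.induction_linear with
    | zero => simp
    | add f₁ f₂ h₁ h₂ =>
      simp only [map_add, add_mul, TensorProduct.tmul_add, LinearMap.add_apply, h₁, h₂]
    | single t v' =>
      rw [rightMul_single, ← hφ, ← hΦ, diamond_tmul, one_mul, (SymmAlgebra.commute _ w).eq]
  | mul s₁ s₂ h₁ h₂ => rw [mul_assoc, h₁, h₂, map_mul, Module.End.mul_apply]
  | add s₁ s₂ h₁ h₂ =>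
    simp only [map_add, add_mul, TensorProduct.tmul_add, LinearMap.add_apply, h₁, h₂]

theorem eq_extend {Φ : PermFree K V T →ₗ[K] A}
    (hΦ : ∀ t x y, Φ (diamond K V T t x y) = dm t (Φ x) (Φ y))
    (hφ : ∀ v, Φ (v ⊗ₜ[K] (1 : SymVT K V T)) = φ v) : Φ = extend φ hcomm := by
  refine TensorProduct.ext' fun v w => ?_
  rw [extend_tmul, ← hφ, ← map_tmul_mul φ hcomm hΦ hφ, mul_one]

end PermFree

/-- `P_𝒯(V) = V ⊗ S(V^{⊕𝒯})` with the products `◇_t` is a `𝒯`-multiple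
permutative algebra, and it is the free one on `V`: for any `𝒯`-multiple permutative
algebra `A` and any linear map `φ : V → A`, there is a unique linear map
`Φ : P_𝒯(V) → A` commuting with the products `◇_t` and with `Φ(v ⊗ 1) = φ(v)`. -/
theorem permFree_is_free_multiple_permutative [Nonempty T] :
    (∀ (t t' : T) (x y z : PermFree K V T),
        diamond K V T t' (diamond K V T t x y) z = diamond K V T t x (diamond K V T t' y z) ∧
        diamond K V T t' (diamond K V T t x y) z = diamond K V T t (diamond K V T t' x z) y) ∧
    (∀ (A : Type) (_ : AddCommGroup A), ∀ (_ : Module K A)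
        (dm : T → A →ₗ[K] A →ₗ[K] A),
        (∀ (t t' : T) (x y z : A),
          dm t' (dm t x y) z = dm t x (dm t' y z) ∧
          dm t' (dm t x y) z = dm t (dm t' x z) y) →
        ∀ φ : V →ₗ[K] A,
          ∃! Φ : PermFree K V T →ₗ[K] A,
            (∀ (t : T) (x y : PermFree K V T), Φ (diamond K V T t x y) = dm t (Φ x) (Φ y)) ∧
            (∀ v : V, Φ (v ⊗ₜ[K] (1 : SymVT K V T)) = φ v)) := by
  refine ⟨fun t t' x y z => ⟨PermFree.diamond_assoc t t' x y z,
    PermFree.diamond_right_comm t t' x y z⟩, ?_⟩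
  intro A _ _ dm h φ
  have hassoc := fun t t' x y z => (h t t' x y z).1
  have hcomm := fun t t' x y z => (h t t' x y z).2
  exact ⟨PermFree.extend φ hcomm,
    ⟨PermFree.extend_diamond φ hcomm hassoc, fun v => by simp⟩,
    fun Φ hΦ => PermFree.eq_extend φ hcomm hΦ.1 hΦ.2⟩
end
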